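/- arXiv:solv-int/9903005 — 2 statements merged into one kernel-verified Lean document; each statement's English description precedes it below -/
import Mathlib

section
/- For every 2N×2N complex matrix a, the matrix π_𝕜(a) := (a₋ - 𝒥(a₊)) + (1/2)(a₀ - 𝒥(a₀)) belongs to 𝕜, and a - π_𝕜(a) = (a₊ + 𝒥(a₊)) + (1/2)(a₀ + 𝒥(a₀)) belongs to 𝕟. Consequently π_𝕜 and π_𝕟 := id - π_𝕜 are the projections of gl(2N,ℂ) onto 𝕜 and 𝕟 associated with the direct sum decomposition gl(2N,ℂ) = 𝕜 ⊕ 𝕟. -/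
open Matrix

/-- The `2N×2N` block-diagonal matrix whose diagonal `2×2` blocks all equal `[[0,1],[-1,0]]`. -/
noncomputable def Jmat (N : ℕ) : Matrix (Fin (2 * N)) (Fin (2 * N)) ℂ :=
  Matrix.of fun i j =>
    if i.val / 2 = j.val / 2 then
      if i.val % 2 = 0 ∧ j.val % 2 = 1 then 1
      else if i.val % 2 = 1 ∧ j.val % 2 = 0 then -1
      else 0
    else 0

/-- The involution `𝒥(a) = J aᵀ J`. -/
noncomputable def Jmap (N : ℕ) (a : Matrix (Fin (2 * N)) (Fin (2 * N)) ℂ) :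
    Matrix (Fin (2 * N)) (Fin (2 * N)) ℂ :=
  Jmat N * aᵀ * Jmat N

/-- Strictly block-lower-triangular part `a₋` (with respect to the `2×2` block structure). -/
noncomputable def bLow (N : ℕ) (a : Matrix (Fin (2 * N)) (Fin (2 * N)) ℂ) :
    Matrix (Fin (2 * N)) (Fin (2 * N)) ℂ :=
  Matrix.of fun i j => if j.val / 2 < i.val / 2 then a i j else 0

/-- Block-diagonal part `a₀` (with respect to the `2×2` block structure). -/
noncomputable def bDiag (N : ℕ) (a : Matrix (Fin (2 * N)) (Fin (2 * N)) ℂ) :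
    Matrix (Fin (2 * N)) (Fin (2 * N)) ℂ :=
  Matrix.of fun i j => if i.val / 2 = j.val / 2 then a i j else 0

/-- Strictly block-upper-triangular part `a₊` (with respect to the `2×2` block structure). -/
noncomputable def bUp (N : ℕ) (a : Matrix (Fin (2 * N)) (Fin (2 * N)) ℂ) :
    Matrix (Fin (2 * N)) (Fin (2 * N)) ℂ :=
  Matrix.of fun i j => if i.val / 2 < j.val / 2 then a i j else 0

/-- `a ∈ 𝒟₀⁻`: block diagonal with each diagonal `2×2` block a scalar multiple of `I₂`. -/
def memD0minus (N : ℕ) (a : Matrix (Fin (2 * N)) (Fin (2 * N)) ℂ) : Prop :=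
  (∀ i j, i ≠ j → a i j = 0) ∧
  (∀ i j : Fin (2 * N), i.val / 2 = j.val / 2 → a i i = a j j)

/-- `a ∈ 𝕜`: block lower triangular with block-diagonal part in `𝒟₀⁻`. -/
def memK (N : ℕ) (a : Matrix (Fin (2 * N)) (Fin (2 * N)) ℂ) : Prop :=
  bUp N a = 0 ∧ memD0minus N (bDiag N a)

/-- `a ∈ 𝕟 = sp(2N)`: fixed points of `𝒥`. -/
def memN (N : ℕ) (a : Matrix (Fin (2 * N)) (Fin (2 * N)) ℂ) : Prop :=
  Jmap N a = a

/-- The projection `π_𝕜(a) = (a₋ - 𝒥(a₊)) + (1/2)(a₀ - 𝒥(a₀))`. -/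
noncomputable def piK (N : ℕ) (a : Matrix (Fin (2 * N)) (Fin (2 * N)) ℂ) :
    Matrix (Fin (2 * N)) (Fin (2 * N)) ℂ :=
  (bLow N a - Jmap N (bUp N a)) +
    (1 / 2 : ℂ) • (bDiag N a - Jmap N (bDiag N a))

def swp (N : ℕ) (i : Fin (2 * N)) : Fin (2 * N) :=
  ⟨if i.val % 2 = 0 then i.val + 1 else i.val - 1, by have := i.isLt; split_ifs <;> omega⟩

noncomputable def sg (N : ℕ) (i : Fin (2 * N)) : ℂ := if i.val % 2 = 0 then 1 else -1

lemma swp_div (N : ℕ) (i : Fin (2 * N)) : (swp N i).val / 2 = i.val / 2 := by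
  simp only [swp]; split_ifs <;> omega

lemma swp_swp (N : ℕ) (i : Fin (2 * N)) : swp N (swp N i) = i := by
  ext; simp only [swp]; split_ifs <;> omega

lemma swp_cases (N : ℕ) (i j : Fin (2 * N)) (h : i.val / 2 = j.val / 2) :
    j = i ∨ j = swp N i := by
  simp only [swp, Fin.ext_iff]; split_ifs <;> omega

lemma swp_ne (N : ℕ) (i : Fin (2 * N)) : swp N i ≠ i := by
  simp only [swp, ne_eq, Fin.ext_iff]; split_ifs <;> omega

lemma sg_swp (N : ℕ) (i : Fin (2 * N)) : sg N (swp N i) = - sg N i := by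
  simp only [swp, sg]
  rcases Nat.mod_two_eq_zero_or_one i.val with h | h
  · have h1 : (i.val + 1) % 2 ≠ 0 := by omega
    simp [h, h1]
  · have h1 : (i.val - 1) % 2 = 0 := by omega
    simp [h, h1]

lemma sg_sq (N : ℕ) (i : Fin (2 * N)) : sg N i * sg N i = 1 := by
  simp only [sg]; split_ifs <;> simp

lemma Jmat_apply (N : ℕ) (i j : Fin (2 * N)) :
    Jmat N i j = if j = swp N i then sg N i else 0 := by
  simp only [Jmat, Matrix.of_apply]
  by_cases h : i.val / 2 = j.val / 2
  · rcases Nat.mod_two_eq_zero_or_one i.val with h1 | h1 <;>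
    rcases Nat.mod_two_eq_zero_or_one j.val with h2 | h2
    all_goals simp [h, h1, h2, swp, sg, Fin.ext_iff]
    all_goals omega
  · have : j ≠ swp N i := fun e => h (by rw [e, swp_div])
    simp [h, this]

lemma Jmap_apply (N : ℕ) (a : Matrix (Fin (2 * N)) (Fin (2 * N)) ℂ) (i j : Fin (2 * N)) :
    Jmap N a i j = - (sg N i * sg N j * a (swp N j) (swp N i)) := by
  have hk : ∀ k, (j = swp N k) ↔ (k = swp N j) := fun k =>
    ⟨fun e => by rw [e, swp_swp], fun e => by rw [e, swp_swp]⟩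
  simp [Jmap, Matrix.mul_apply, Jmat_apply, hk, sg_swp]
  ring

lemma Jmap_Jmap (N : ℕ) (a : Matrix (Fin (2 * N)) (Fin (2 * N)) ℂ) :
    Jmap N (Jmap N a) = a := by
  ext i j
  simp only [Jmap_apply, swp_swp, sg_swp]
  linear_combination (sg N i * sg N i * a i j) * sg_sq N j + a i j * sg_sq N i

lemma Jmap_add (N : ℕ) (a b : Matrix (Fin (2 * N)) (Fin (2 * N)) ℂ) :
    Jmap N (a + b) = Jmap N a + Jmap N b := by
  simp [Jmap, mul_add, add_mul]

lemma Jmap_smul (N : ℕ) (c : ℂ) (a : Matrix (Fin (2 * N)) (Fin (2 * N)) ℂ) :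
    Jmap N (c • a) = c • Jmap N a := by
  simp [Jmap]

lemma piK_apply (N : ℕ) (a : Matrix (Fin (2 * N)) (Fin (2 * N)) ℂ) (i j : Fin (2 * N)) :
    piK N a i j = if j.val / 2 < i.val / 2 then a i j - Jmap N a i j
      else if i.val / 2 = j.val / 2 then (1 / 2 : ℂ) * (a i j - Jmap N a i j) else 0 := by
  simp only [piK, Matrix.add_apply, Matrix.sub_apply, Matrix.smul_apply, Jmap_apply, bLow, bUp,
    bDiag, Matrix.of_apply, swp_div, smul_eq_mul]
  rcases lt_trichotomy (i.val / 2) (j.val / 2) with h | h | h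
  · simp [h.ne, h.ne', h.not_gt]
  · simp [h]
  · simp [h, h.ne, h.ne']

lemma sub_piK (N : ℕ) (a : Matrix (Fin (2 * N)) (Fin (2 * N)) ℂ) :
    a - piK N a =
      (bUp N a + Jmap N (bUp N a)) + (1 / 2 : ℂ) • (bDiag N a + Jmap N (bDiag N a)) := by
  have h : a = bLow N a + bDiag N a + bUp N a := by
    ext i j
    simp only [bLow, bUp, bDiag, Matrix.add_apply, Matrix.of_apply]
    rcases lt_trichotomy (i.val / 2) (j.val / 2) with h | h | h
    · simp [h, h.ne, h.not_gt]
    · simp [h]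
    · simp [h, h.ne', h.not_gt]
  have h2 : a - piK N a = (bLow N a + bDiag N a + bUp N a) - piK N a := by rw [← h]
  rw [h2, piK]
  module

theorem piK_is_projection_onto_k (N : ℕ) (hN : 1 ≤ N)
    (a : Matrix (Fin (2 * N)) (Fin (2 * N)) ℂ) :
    memK N (piK N a) ∧
    a - piK N a =
      (bUp N a + Jmap N (bUp N a)) + (1 / 2 : ℂ) • (bDiag N a + Jmap N (bDiag N a)) ∧
    memN N (a - piK N a) ∧
    (memK N a → piK N a = a) ∧
    (memN N a → piK N a = 0) := by
  refine ⟨⟨?_, ?_, ?_⟩, sub_piK N a, ?_, ?_, ?_⟩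
  · ext i j
    simp only [bUp, Matrix.of_apply, piK_apply, Matrix.zero_apply]
    by_cases h : i.val / 2 < j.val / 2
    · simp [h, h.ne, h.not_gt]
    · simp [h]
  · intro i j hij
    simp only [bDiag, Matrix.of_apply]
    by_cases h : i.val / 2 = j.val / 2
    · rcases swp_cases N i j h with rfl | rfl
      · exact absurd rfl hij
      · simp only [piK_apply, Jmap_apply, swp_div, swp_swp, sg_swp, lt_irrefl, if_true, if_false]
        linear_combination (-(1 / 2 : ℂ) * a i (swp N i)) * sg_sq N i
    · simp [h]
  · intro i j h
    rcases swp_cases N i j h with rfl | rfl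
    · rfl
    · simp only [bDiag, Matrix.of_apply, piK_apply, Jmap_apply, swp_div, swp_swp, sg_swp,
        lt_irrefl, if_true, if_false]
      linear_combination ((1 / 2 : ℂ) * (a (swp N i) (swp N i) - a i i)) * sg_sq N i
  · rw [memN, sub_piK]
    simp only [Jmap_add, Jmap_smul, Jmap_Jmap]
    module
  · rintro ⟨h1, h2, h3⟩
    have hu : ∀ i j : Fin (2 * N), i.val / 2 < j.val / 2 → a i j = 0 := by
      intro i j h
      have := congrFun (congrFun h1 i) j
      simpa [bUp, h] using this
    ext i j
    rw [piK_apply, Jmap_apply]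
    rcases lt_trichotomy (i.val / 2) (j.val / 2) with h | h | h
    · simp [h.ne, h.not_gt, hu i j h]
    · rcases swp_cases N i j h with rfl | rfl
      · have := h3 j (swp N j) (swp_div N j).symm
        simp only [bDiag, Matrix.of_apply, if_true] at this
        simp only [lt_irrefl, if_true, if_false, ← this]
        linear_combination ((1 / 2 : ℂ) * a j j) * sg_sq N j
      · have := h2 i (swp N i) (swp_ne N i).symm
        simp only [bDiag, Matrix.of_apply, swp_div, if_true] at this
        simp [swp_div, swp_swp, this]
    · have := hu (swp N j) (swp N i) (by simpa only [swp_div] using h)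
      simp [h, this]
  · intro h
    ext i j
    rw [piK_apply, show Jmap N a = a from h]
    simp
end

section
/- Assume τ_{2m} ≠ 0 for all m. Then the monic polynomials p₀, p₁, p₂, … are skew-orthogonal: for all n, m ≥ 0, ⟨p_{2n}, p_{2m}⟩ = 0, ⟨p_{2n+1}, p_{2m+1}⟩ = 0, and ⟨p_{2n}, p_{2m+1}⟩ = δ_{nm} · τ_{2n+2}/τ_{2n} (equivalently, the semi-infinite matrix (⟨p_i, p_j⟩)_{i,j≥0} equals J·h̃, where J is the block-diagonal matrix of 2×2 blocks [[0,1],[-1,0]] and h̃ is the diagonal matrix diag(h̃₀,h̃₀,h̃₂,h̃₂,…) with h̃_{2n} = τ_{2n+2}/τ_{2n}). -/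
open Matrix

/-- The Pfaffian of a `2m×2m` matrix `A`, defined by the permutation sum
`pf(A) = (1/(2^m m!)) Σ_{σ} sgn(σ) A_{σ(0)σ(1)} A_{σ(2)σ(3)} ⋯ A_{σ(2m-2)σ(2m-1)}`. -/
noncomputable def pf (m : ℕ) (A : Matrix (Fin (2 * m)) (Fin (2 * m)) ℂ) : ℂ :=
  (1 / ((2 : ℂ) ^ m * (Nat.factorial m : ℂ))) *
    ∑ σ : Equiv.Perm (Fin (2 * m)),
      ((Equiv.Perm.sign σ : ℤ) : ℂ) *
        ∏ p : Fin m,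
          A (σ ⟨2 * p.val, by have := p.isLt; omega⟩)
            (σ ⟨2 * p.val + 1, by have := p.isLt; omega⟩)

/-- `pf(j₀,…,j_{2m-1})`: the Pfaffian of the `2m×2m` skew-symmetric matrix
`(μ_{j_a j_b})` built from the array `μ` and the index list `v`. -/
noncomputable def pfv (m : ℕ) (μ : ℕ → ℕ → ℂ) (v : Fin (2 * m) → ℕ) : ℂ :=
  pf m (Matrix.of fun a b => μ (v a) (v b))
/-- `τ_{2n} = pf(0,1,…,2n-1)` (so `τ₀ = 1`). -/
noncomputable def tau (μ : ℕ → ℕ → ℂ) (n : ℕ) : ℂ :=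
  pfv n μ (fun a => a.val)

/-- `pf(0,…,k̂,…,2n)`. -/
noncomputable def pfOmitEven (μ : ℕ → ℕ → ℂ) (n k : ℕ) : ℂ :=
  pfv n μ (fun a => if a.val < k then a.val else a.val + 1)

/-- `pf(0,…,k̂,…,2n-1,2n+1)`. -/
noncomputable def pfOmitOdd (μ : ℕ → ℕ → ℂ) (n k : ℕ) : ℂ :=
  pfv n μ (fun a =>
    if a.val < k then a.val
    else if a.val < 2 * n - 1 then a.val + 1
    else 2 * n + 1)

/-- The monic polynomial `p_{2n}(z) = (1/τ_{2n}) Σ_{k=0}^{2n} (-z)^k pf(0,…,k̂,…,2n)`. -/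
noncomputable def pEven (μ : ℕ → ℕ → ℂ) (n : ℕ) : Polynomial ℂ :=
  Polynomial.C (tau μ n)⁻¹ *
    ∑ k ∈ Finset.range (2 * n + 1),
      Polynomial.C ((-1) ^ k * pfOmitEven μ n k) * Polynomial.X ^ k

/-- The monic polynomial
`p_{2n+1}(z) = z^{2n+1} + (1/τ_{2n}) Σ_{k=0}^{2n-1} (-z)^k pf(0,…,k̂,…,2n-1,2n+1)`. -/
noncomputable def pOdd (μ : ℕ → ℕ → ℂ) (n : ℕ) : Polynomial ℂ :=
  Polynomial.X ^ (2 * n + 1) +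
    Polynomial.C (tau μ n)⁻¹ *
      ∑ k ∈ Finset.range (2 * n),
        Polynomial.C ((-1) ^ k * pfOmitOdd μ n k) * Polynomial.X ^ k

/-- The skew inner product `⟨Σ aᵢ zⁱ, Σ bⱼ zʲ⟩ = Σ aᵢ bⱼ μ_{ij}` on polynomials. -/
noncomputable def skewForm (μ : ℕ → ℕ → ℂ) (p q : Polynomial ℂ) : ℂ :=
  ∑ i ∈ Finset.range (p.natDegree + 1), ∑ j ∈ Finset.range (q.natDegree + 1),
    p.coeff i * q.coeff j * μ i j

open Equiv in
lemma sum_perm_succ {N : ℕ} (F : (Fin (N+1) → Fin (N+1)) → ℂ) :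
    ∑ σ : Perm (Fin (N+1)), ((Perm.sign σ : ℤ) : ℂ) * F σ =
    ∑ k : Fin (N+1), (-1) ^ (k : ℕ) * ∑ τ : Perm (Fin N), ((Perm.sign τ : ℤ) : ℂ) *
      F (Fin.cons k (fun i => k.succAbove (τ i))) := by
  rw [← Equiv.sum_comp Equiv.Perm.decomposeFin.symm, Fintype.sum_prod_type]
  refine Finset.sum_congr rfl fun k _ => ?_
  have key : ∀ τ : Perm (Fin N), (⇑(Equiv.Perm.decomposeFin.symm (k, τ)) : Fin (N+1) → Fin (N+1))
      = Fin.cons k (fun i => swap 0 k (τ i).succ) := by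
    intro τ
    funext x
    refine Fin.cases ?_ (fun x => ?_) x
    · simp
    · simp
  simp only [key, Equiv.Perm.decomposeFin.symm_sign]
  revert key
  refine Fin.cases ?_ (fun i => ?_) k
  · intro _
    simp
  · intro _
    rw [← Equiv.sum_comp (Equiv.mulLeft (i.cycleRange)) (fun τ : Perm (Fin N) =>
      ((Perm.sign τ : ℤ) : ℂ) * F (Fin.cons i.succ (fun j => i.succ.succAbove (τ j)))),
      Finset.mul_sum]
    refine Finset.sum_congr rfl fun τ _ => ?_
    simp only [Equiv.coe_mulLeft, Perm.mul_apply, Fin.succAbove_cycleRange, Perm.sign_mul,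
      Fin.sign_cycleRange, Fin.succ_ne_zero, if_false, Fin.val_succ]
    push_cast
    have : ((-1:ℂ)^(i:ℕ))*((-1:ℂ)^(i:ℕ)) = 1 := by rw [← mul_pow]; simp
    rw [pow_succ]
    linear_combination (-(((Perm.sign τ : ℤ) : ℂ) *
      F (Fin.cons i.succ (fun j => swap 0 i.succ (τ j).succ)))) * (-this)

def evI (m : ℕ) (p : Fin m) : Fin (2 * m) := ⟨2 * p.val, by have := p.isLt; omega⟩
def odI (m : ℕ) (p : Fin m) : Fin (2 * m) := ⟨2 * p.val + 1, by have := p.isLt; omega⟩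

noncomputable def pfS (m : ℕ) (A : Fin (2 * m) → Fin (2 * m) → ℂ) : ℂ :=
  ∑ σ : Equiv.Perm (Fin (2 * m)), ((Equiv.Perm.sign σ : ℤ) : ℂ) *
    ∏ p : Fin m, A (σ (evI m p)) (σ (odI m p))

noncomputable def pfT (m : ℕ) (A : Fin (2 * m) → Fin (2 * m) → ℂ) (z q : Fin (2 * m)) : ℂ :=
  ∑ σ : Equiv.Perm (Fin (2 * m)), ((Equiv.Perm.sign σ : ℤ) : ℂ) *
    (if σ q = z then ∏ p : Fin m, A (σ (evI m p)) (σ (odI m p)) else 0)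

lemma pfS_eq_sum (m : ℕ) (A : Fin (2 * m) → Fin (2 * m) → ℂ) (z : Fin (2 * m)) :
    pfS m A = ∑ q, pfT m A z q := by
  unfold pfS pfT
  rw [Finset.sum_comm]
  refine Finset.sum_congr rfl fun σ _ => ?_
  rw [← Finset.mul_sum]
  congr 1
  rw [Finset.sum_eq_single (σ.symm z)]
  · simp
  · intro b _ hb
    rw [if_neg]
    rintro rfl
    simp at hb
  · simp

lemma evI_inj {m : ℕ} {p r : Fin m} : evI m p = evI m r ↔ p = r := by
  simp [evI, Fin.ext_iff]
lemma odI_inj {m : ℕ} {p r : Fin m} : odI m p = odI m r ↔ p = r := by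
  simp [odI, Fin.ext_iff]
lemma evI_ne {m : ℕ} (p r : Fin m) : evI m p ≠ odI m r := by
  simp only [evI, odI, ne_eq, Fin.ext_iff]; omega

lemma pfT_od (m : ℕ) (A : Fin (2 * m) → Fin (2 * m) → ℂ) (hA : ∀ i j, A i j = - A j i)
    (z : Fin (2 * m)) (p : Fin m) : pfT m A z (odI m p) = pfT m A z (evI m p) := by
  unfold pfT
  rw [← Equiv.sum_comp (Equiv.mulRight (Equiv.swap (evI m p) (odI m p)))]
  refine Finset.sum_congr rfl fun σ _ => ?_
  have h : ∏ x : Fin m, A ((σ * Equiv.swap (evI m p) (odI m p)) (evI m x))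
      ((σ * Equiv.swap (evI m p) (odI m p)) (odI m x)) =
      - ∏ x : Fin m, A (σ (evI m x)) (σ (odI m x)) := by
    rw [← Finset.mul_prod_erase _ _ (Finset.mem_univ p),
      ← Finset.mul_prod_erase Finset.univ (fun x => A (σ (evI m x)) (σ (odI m x)))
        (Finset.mem_univ p), ← neg_mul]
    congr 1
    · simp [hA (σ (odI m p))]
    · refine Finset.prod_congr rfl fun x hx => ?_
      have hx : x ≠ p := Finset.ne_of_mem_erase hx
      rw [Equiv.Perm.mul_apply, Equiv.Perm.mul_apply, Equiv.swap_apply_of_ne_of_ne,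
        Equiv.swap_apply_of_ne_of_ne]
      · exact (evI_ne _ _).symm
      · rwa [Ne, odI_inj]
      · rwa [Ne, evI_inj]
      · exact evI_ne _ _
  simp only [Equiv.coe_mulRight, h, Equiv.Perm.sign_mul, Equiv.Perm.sign_swap (evI_ne p p)]
  have hz : (σ * Equiv.swap (evI m p) (odI m p)) (odI m p) = σ (evI m p) := by simp
  rw [hz]
  split_ifs <;> simp

lemma pfT_ev (m : ℕ) (A : Fin (2 * m) → Fin (2 * m) → ℂ)
    (z : Fin (2 * m)) (p r : Fin m) : pfT m A z (evI m p) = pfT m A z (evI m r) := by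
  by_cases hpr : p = r
  · rw [hpr]
  unfold pfT
  set ρ := Equiv.swap (evI m p) (evI m r) * Equiv.swap (odI m p) (odI m r) with hρ
  have he : ∀ x, ρ (evI m x) = evI m (Equiv.swap p r x) := by
    intro x
    rw [hρ, Equiv.Perm.mul_apply, Equiv.swap_apply_of_ne_of_ne (evI_ne _ _) (evI_ne _ _)]
    simp only [Equiv.swap_apply_def, evI_inj]
    split_ifs <;> rfl
  have ho : ∀ x, ρ (odI m x) = odI m (Equiv.swap p r x) := by
    intro x
    rw [hρ, Equiv.Perm.mul_apply]
    have : Equiv.swap (odI m p) (odI m r) (odI m x) = odI m (Equiv.swap p r x) := by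
      simp only [Equiv.swap_apply_def, odI_inj]
      split_ifs <;> rfl
    rw [this, Equiv.swap_apply_of_ne_of_ne (evI_ne _ _).symm (evI_ne _ _).symm]
  have hs : Equiv.Perm.sign ρ = 1 := by
    rw [hρ, Equiv.Perm.sign_mul, Equiv.Perm.sign_swap (by rwa [Ne, evI_inj]),
      Equiv.Perm.sign_swap (by rwa [Ne, odI_inj])]
    simp
  rw [← Equiv.sum_comp (Equiv.mulRight ρ)]
  refine Finset.sum_congr rfl fun σ _ => ?_
  simp only [Equiv.coe_mulRight, Equiv.Perm.mul_apply, he, ho, Equiv.Perm.sign_mul, hs, mul_one,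
    Equiv.swap_apply_left]
  rw [Equiv.prod_comp (Equiv.swap p r) (fun x => A (σ (evI m x)) (σ (odI m x)))]

lemma pfT_const (n : ℕ) (A : Fin (2 * (n+1)) → Fin (2 * (n+1)) → ℂ) (hA : ∀ i j, A i j = - A j i)
    (z q : Fin (2 * (n+1))) : pfT (n+1) A z q = pfT (n+1) A z (evI (n+1) 0) := by
  have hq := q.isLt
  rcases Nat.even_or_odd' q.val with ⟨c, hc | hc⟩
  · have : q = evI (n+1) ⟨c, by omega⟩ := Fin.ext hc
    rw [this]; exact pfT_ev _ _ _ _ _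
  · have : q = odI (n+1) ⟨c, by omega⟩ := Fin.ext hc
    rw [this, pfT_od _ _ hA]; exact pfT_ev _ _ _ _ _

lemma pfT_zero (n : ℕ) (A : Fin (2 * n + 1 + 1) → Fin (2 * n + 1 + 1) → ℂ) :
    pfT (n+1) A (evI (n+1) 0) (evI (n+1) 0) = ∑ k : Fin (2 * n + 1), (-1) ^ (k : ℕ) *
      (A 0 k.succ * pfS n (fun a b => A (k.succAbove a).succ (k.succAbove b).succ)) := by
  have h1 := sum_perm_succ (N := 2 * n + 1) (fun f =>
    if f 0 = 0 then ∏ p : Fin (n+1), A (f (evI (n+1) p)) (f (odI (n+1) p)) else 0)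
  have h0 : pfT (n+1) A (evI (n+1) 0) (evI (n+1) 0) =
    ∑ σ : Equiv.Perm (Fin (2*n+1+1)), ((Equiv.Perm.sign σ : ℤ) : ℂ) * (if σ 0 = 0 then
      ∏ p : Fin (n+1), A (σ (evI (n+1) p)) (σ (odI (n+1) p)) else 0) := rfl
  rw [h0, h1, Finset.sum_eq_single 0]
  rotate_left
  · intro b _ hb
    simp [hb]
  · simp
  simp only [Fin.val_zero, pow_zero, one_mul, Fin.cons_zero, if_true]
  rw [sum_perm_succ (N := 2 * n) (fun g => ∏ p : Fin (n+1),
    A ((Fin.cons 0 (fun i => (0 : Fin (2*n+1+1)).succAbove (g i)) : Fin (2*n+1+1) → Fin (2*n+1+1)) (evI (n+1) p))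
      ((Fin.cons 0 (fun i => (0 : Fin (2*n+1+1)).succAbove (g i)) : Fin (2*n+1+1) → Fin (2*n+1+1)) (odI (n+1) p)))]
  refine Finset.sum_congr rfl fun k _ => ?_
  congr 1
  unfold pfS
  rw [Finset.mul_sum]
  refine Finset.sum_congr rfl fun τ _ => ?_
  rw [Fin.prod_univ_succ, mul_left_comm]
  congr 1

lemma pfS_succ (n : ℕ) (A : Fin (2 * n + 1 + 1) → Fin (2 * n + 1 + 1) → ℂ)
    (hA : ∀ i j, A i j = - A j i) :
    pfS (n+1) A = 2 * (n + 1) * ∑ k : Fin (2 * n + 1), (-1) ^ (k : ℕ) *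
      (A 0 k.succ * pfS n (fun a b => A (k.succAbove a).succ (k.succAbove b).succ)) := by
  rw [pfS_eq_sum (n+1) A (evI (n+1) 0), ← pfT_zero,
    Finset.sum_congr rfl (fun q _ => pfT_const n A hA (evI (n+1) 0) q)]
  simp

lemma pfv_eq (m : ℕ) (μ : ℕ → ℕ → ℂ) (v : Fin (2 * m) → ℕ) :
    pfv m μ v = (1 / ((2 : ℂ) ^ m * (Nat.factorial m : ℂ))) * pfS m (fun a b => μ (v a) (v b)) :=
  rfl

lemma pfv_cons (n : ℕ) (μ : ℕ → ℕ → ℂ) (hskew : ∀ i j, μ i j = -μ j i)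
    (w : Fin (2 * n + 1) → ℕ) (j : ℕ) :
    pfv (n+1) μ (Fin.cons j w : Fin (2 * n + 1 + 1) → ℕ) = ∑ k : Fin (2 * n + 1), (-1) ^ (k : ℕ) *
      (μ j (w k) * pfv n μ (fun a => w (k.succAbove a))) := by
  have hS := pfS_succ n (fun a b => μ ((Fin.cons j w : Fin (2 * n + 1 + 1) → ℕ) a)
    ((Fin.cons j w : Fin (2 * n + 1 + 1) → ℕ) b)) (fun a b => hskew _ _)
  refine (congrArg (fun t => (1 / ((2 : ℂ) ^ (n+1) * (Nat.factorial (n+1) : ℂ))) * t) hS).trans ?_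
  rw [← mul_assoc, Finset.mul_sum]
  refine Finset.sum_congr rfl fun k _ => ?_
  rw [pfv_eq]
  simp only [Fin.cons_zero, Fin.cons_succ, Nat.factorial_succ]
  have : (n:ℂ) + 1 ≠ 0 := by exact_mod_cast Nat.succ_ne_zero n
  have : (Nat.factorial n : ℂ) ≠ 0 := by exact_mod_cast Nat.factorial_ne_zero n
  push_cast
  field_simp
  ring

lemma pfv_perm (m : ℕ) (μ : ℕ → ℕ → ℂ) (v : Fin (2 * m) → ℕ) (ρ : Equiv.Perm (Fin (2 * m))) :
    pfv m μ (fun a => v (ρ a)) = ((Equiv.Perm.sign ρ : ℤ) : ℂ) * pfv m μ v := by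
  rw [pfv_eq, pfv_eq, mul_left_comm]
  congr 1
  unfold pfS
  rw [← Equiv.sum_comp (Equiv.mulLeft ρ) (fun σ : Equiv.Perm (Fin (2 * m)) =>
    ((Equiv.Perm.sign σ : ℤ) : ℂ) * ∏ p : Fin m, μ (v (σ (evI m p))) (v (σ (odI m p)))),
    Finset.mul_sum]
  refine Finset.sum_congr rfl fun σ _ => ?_
  simp only [Equiv.coe_mulLeft, Equiv.Perm.sign_mul, Equiv.Perm.mul_apply]
  push_cast
  rw [← mul_assoc, ← mul_assoc, ← Int.cast_mul, ← Units.val_mul, Int.units_mul_self]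
  simp

lemma pfv_repeat (m : ℕ) (μ : ℕ → ℕ → ℂ) (v : Fin (2 * m) → ℕ) (a b : Fin (2 * m))
    (hab : a ≠ b) (h : v a = v b) : pfv m μ v = 0 := by
  have h1 := pfv_perm m μ v (Equiv.swap a b)
  have h2 : (fun x => v (Equiv.swap a b x)) = v := by
    funext x
    simp only [Equiv.swap_apply_def]
    split_ifs with h3 h4
    · rw [h3, h]
    · rw [h4, h]
    · rfl
  rw [h2, Equiv.Perm.sign_swap hab] at h1
  simp at h1
  linear_combination h1 / 2

/-- row functional -/
noncomputable def rowF (n : ℕ) (μ : ℕ → ℕ → ℂ) (w : Fin (2 * n + 1) → ℕ) (j : ℕ) : ℂ :=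
  ∑ k : Fin (2 * n + 1), (-1) ^ (k : ℕ) * pfv n μ (fun a => w (k.succAbove a)) * μ (w k) j

lemma rowF_eq (n : ℕ) (μ : ℕ → ℕ → ℂ) (hskew : ∀ i j, μ i j = -μ j i)
    (w : Fin (2 * n + 1) → ℕ) (j : ℕ) :
    rowF n μ w j = - pfv (n+1) μ (Fin.cons j w : Fin (2 * n + 1 + 1) → ℕ) := by
  rw [pfv_cons n μ hskew, ← Finset.sum_neg_distrib]
  refine Finset.sum_congr rfl fun k _ => ?_
  rw [hskew (w k) j]; ring

lemma rowF_mem (n : ℕ) (μ : ℕ → ℕ → ℂ) (hskew : ∀ i j, μ i j = -μ j i)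
    (w : Fin (2 * n + 1) → ℕ) (k : Fin (2 * n + 1)) : rowF n μ w (w k) = 0 := by
  rw [rowF_eq n μ hskew, pfv_repeat (n+1) μ _ (0 : Fin (2*n+1+1)) k.succ (Fin.succ_ne_zero k).symm,
    neg_zero]
  rfl

lemma rowF_top (n : ℕ) (μ : ℕ → ℕ → ℂ) (hskew : ∀ i j, μ i j = -μ j i) :
    rowF n μ (fun a => a.val) (2 * n + 1) = tau μ (n + 1) := by
  have h := pfv_perm (n+1) μ (Fin.cons (2 * n + 1) (fun a => a.val) : Fin (2 * n + 1 + 1) → ℕ)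
    (finRotate (2 * n + 1 + 1))
  have h2 : (fun a => (Fin.cons (2 * n + 1) (fun a => a.val) : Fin (2 * n + 1 + 1) → ℕ)
    (finRotate (2 * n + 1 + 1) a)) = fun a => a.val := by
    funext a
    refine Fin.lastCases ?_ (fun a => ?_) a
    · rw [finRotate_last]; simp
    · have : finRotate (2 * n + 1 + 1) a.castSucc = a.succ := by
        rw [finRotate_apply]; simp
      rw [this]; simp
  have hs : Equiv.Perm.sign (finRotate (2 * n + 1 + 1)) = -1 := by
    rw [sign_finRotate]; simp [pow_succ, pow_mul]
  rw [rowF_eq n μ hskew, tau]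
  have h3 : pfv (n+1) μ (fun a => a.val) = ((-1 : ℤ) : ℂ) *
      pfv (n+1) μ (Fin.cons (2 * n + 1) (fun a => a.val) : Fin (2 * n + 1 + 1) → ℕ) := by
    refine (congrArg (pfv (n+1) μ) h2).symm.trans (h.trans ?_)
    refine congrArg (fun t : ℤˣ => ((t : ℤ) : ℂ) *
      pfv (n+1) μ (Fin.cons (2 * n + 1) (fun a => a.val) : Fin (2 * n + 1 + 1) → ℕ)) hs
  rw [h3]; simp

/-- row of a polynomial -/
noncomputable def rowP (μ : ℕ → ℕ → ℂ) (p : Polynomial ℂ) (j : ℕ) : ℂ :=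
  p.sum (fun i a => a * μ i j)

lemma skewForm_rowP (μ : ℕ → ℕ → ℂ) (p q : Polynomial ℂ) :
    skewForm μ p q = ∑ j ∈ Finset.range (q.natDegree + 1), q.coeff j * rowP μ p j := by
  unfold skewForm rowP
  rw [Finset.sum_comm]
  refine Finset.sum_congr rfl fun j _ => ?_
  rw [Polynomial.sum_over_range _ (by simp), Finset.mul_sum]
  refine Finset.sum_congr rfl fun i _ => ?_
  ring

lemma skewForm_antisymm (μ : ℕ → ℕ → ℂ) (hskew : ∀ i j, μ i j = -μ j i) (p q : Polynomial ℂ) :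
    skewForm μ p q = - skewForm μ q p := by
  unfold skewForm
  rw [Finset.sum_comm, ← Finset.sum_neg_distrib]
  refine Finset.sum_congr rfl fun j _ => ?_
  rw [← Finset.sum_neg_distrib]
  refine Finset.sum_congr rfl fun i _ => ?_
  rw [hskew i j]; ring

lemma skewForm_zero (μ : ℕ → ℕ → ℂ) (p q : Polynomial ℂ) (d : ℕ) (hd : q.natDegree ≤ d)
    (h : ∀ j ≤ d, rowP μ p j = 0) : skewForm μ p q = 0 := by
  rw [skewForm_rowP]
  refine Finset.sum_eq_zero fun j hj => ?_
  rw [h j (by have := Finset.mem_range.mp hj; omega), mul_zero]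

lemma rowP_add (μ : ℕ → ℕ → ℂ) (p q : Polynomial ℂ) (j : ℕ) :
    rowP μ (p + q) j = rowP μ p j + rowP μ q j :=
  Polynomial.sum_add_index _ _ _ (by simp) (by intros; ring)

lemma rowP_C_mul (μ : ℕ → ℕ → ℂ) (c : ℂ) (p : Polynomial ℂ) (j : ℕ) :
    rowP μ (Polynomial.C c * p) j = c * rowP μ p j := by
  unfold rowP
  rw [← Polynomial.smul_eq_C_mul, Polynomial.sum_smul_index _ _ _ (by simp), Polynomial.sum,
    Polynomial.sum, Finset.mul_sum]
  refine Finset.sum_congr rfl fun i _ => ?_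
  ring

lemma rowP_monomial (μ : ℕ → ℕ → ℂ) (c : ℂ) (k : ℕ) (j : ℕ) :
    rowP μ (Polynomial.C c * Polynomial.X ^ k) j = c * μ k j :=
  by rw [Polynomial.C_mul_X_pow_eq_monomial]; exact Polynomial.sum_monomial_index _ _ (by simp)

lemma rowP_sum (μ : ℕ → ℕ → ℂ) (N : ℕ) (c : ℕ → ℂ) (j : ℕ) :
    rowP μ (∑ k ∈ Finset.range N, Polynomial.C (c k) * Polynomial.X ^ k) j =
      ∑ k ∈ Finset.range N, c k * μ k j := by
  induction N with
  | zero => simp [rowP]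
  | succ N ih => rw [Finset.sum_range_succ, Finset.sum_range_succ, rowP_add, ih, rowP_monomial]

lemma val_succAbove {N : ℕ} (k : Fin (N + 1)) (a : Fin N) :
    (k.succAbove a).val = if a.val < k.val then a.val else a.val + 1 := by
  simp only [Fin.succAbove, Fin.lt_def, Fin.val_castSucc]
  split_ifs <;> simp

lemma rowP_pEven (μ : ℕ → ℕ → ℂ) (n j : ℕ) :
    rowP μ (pEven μ n) j = (tau μ n)⁻¹ * rowF n μ (fun a => a.val) j := by
  unfold pEven rowF
  rw [rowP_C_mul, rowP_sum μ _ (fun k => (-1) ^ k * pfOmitEven μ n k), Finset.sum_range]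
  simp only [pfOmitEven, val_succAbove]

lemma rowP_pOdd (μ : ℕ → ℕ → ℂ) (n j : ℕ) (ht : tau μ n ≠ 0) :
    rowP μ (pOdd μ n) j =
      (tau μ n)⁻¹ * rowF n μ (fun a => if a.val < 2 * n then a.val else 2 * n + 1) j := by
  unfold pOdd rowF
  have h1 := rowP_monomial μ 1 (2 * n + 1) j
  rw [Polynomial.C_1, one_mul] at h1
  rw [rowP_add, h1, rowP_C_mul, rowP_sum μ _ (fun k => (-1) ^ k * pfOmitOdd μ n k),
    Finset.sum_range, Fin.sum_univ_castSucc, mul_add, add_comm]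
  congr 1
  · congr 1
    refine Finset.sum_congr rfl fun k _ => ?_
    have hk := k.isLt
    simp only [Fin.val_castSucc, hk, if_true, pfOmitOdd]
    congr 3
    funext a
    have ha := a.isLt
    simp only [val_succAbove, Fin.val_castSucc]
    split_ifs <;> omega
  · have : pfv n μ (fun a => if ((Fin.last (2 * n)).succAbove a).val < 2 * n then
        ((Fin.last (2 * n)).succAbove a).val else 2 * n + 1) = tau μ n := by
      unfold tau
      congr 1
      funext a
      simp
    rw [this]
    simp
    field_simp

lemma rowP_pEven_zero (μ : ℕ → ℕ → ℂ) (hskew : ∀ i j, μ i j = -μ j i) (n j : ℕ) (hj : j ≤ 2 * n) :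
    rowP μ (pEven μ n) j = 0 := by
  rw [rowP_pEven]
  have := rowF_mem n μ hskew (fun a => a.val) ⟨j, by omega⟩
  simp only at this
  rw [this, mul_zero]

lemma rowP_pOdd_zero (μ : ℕ → ℕ → ℂ) (hskew : ∀ i j, μ i j = -μ j i) (n j : ℕ)
    (ht : tau μ n ≠ 0) (hj : j < 2 * n) :
    rowP μ (pOdd μ n) j = 0 := by
  rw [rowP_pOdd _ _ _ ht]
  have := rowF_mem n μ hskew (fun a => if a.val < 2 * n then a.val else 2 * n + 1) ⟨j, by omega⟩
  simp only [hj, if_true] at this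
  rw [this, mul_zero]

lemma natDegree_sum_le' (N d : ℕ) (c : ℕ → ℂ) (h : ∀ k < N, k ≤ d) :
    (∑ k ∈ Finset.range N, Polynomial.C (c k) * Polynomial.X ^ k).natDegree ≤ d :=
  Polynomial.natDegree_sum_le_of_forall_le _ _ fun k hk =>
    (Polynomial.natDegree_C_mul_X_pow_le _ _).trans (h k (Finset.mem_range.mp hk))

lemma pEven_deg (μ : ℕ → ℕ → ℂ) (n : ℕ) : (pEven μ n).natDegree ≤ 2 * n :=
  (Polynomial.natDegree_C_mul_le _ _).trans (natDegree_sum_le' _ _ _ (by intros; omega))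

lemma pOdd_low_deg (μ : ℕ → ℕ → ℂ) (n : ℕ) : (Polynomial.C (tau μ n)⁻¹ *
      ∑ k ∈ Finset.range (2 * n),
        Polynomial.C ((-1) ^ k * pfOmitOdd μ n k) * Polynomial.X ^ k).natDegree ≤ 2 * n :=
  (Polynomial.natDegree_C_mul_le _ _).trans (natDegree_sum_le' _ _ _ (by intros; omega))

lemma pOdd_coeff (μ : ℕ → ℕ → ℂ) (n : ℕ) : (pOdd μ n).coeff (2 * n + 1) = 1 := by
  unfold pOdd
  rw [Polynomial.coeff_add, Polynomial.coeff_X_pow, if_pos rfl,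
    Polynomial.coeff_eq_zero_of_natDegree_lt (Nat.lt_succ_of_le (pOdd_low_deg μ n)), add_zero]

lemma pOdd_deg (μ : ℕ → ℕ → ℂ) (n : ℕ) : (pOdd μ n).natDegree = 2 * n + 1 := by
  refine le_antisymm ?_ (Polynomial.le_natDegree_of_ne_zero (by rw [pOdd_coeff]; simp))
  unfold pOdd
  refine Polynomial.natDegree_add_le_of_degree_le (by simp) ?_
  exact (pOdd_low_deg μ n).trans (by omega)

theorem skew_orthogonality_of_p (μ : ℕ → ℕ → ℂ)
    (hskew : ∀ i j, μ i j = -μ j i) (htau : ∀ m, tau μ m ≠ 0) :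
    ∀ n m : ℕ,
      skewForm μ (pEven μ n) (pEven μ m) = 0 ∧
      skewForm μ (pOdd μ n) (pOdd μ m) = 0 ∧
      skewForm μ (pEven μ n) (pOdd μ m) =
        (if n = m then tau μ (n + 1) / tau μ n else 0) := by
  have hee : ∀ n m, m ≤ n → skewForm μ (pEven μ n) (pEven μ m) = 0 := fun n m h =>
    skewForm_zero μ _ _ (2 * m) (pEven_deg μ m)
      fun j hj => rowP_pEven_zero μ hskew n j (by omega)
  have hoo : ∀ n m, m < n → skewForm μ (pOdd μ n) (pOdd μ m) = 0 := fun n m h =>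
    skewForm_zero μ _ _ (2 * m + 1) (pOdd_deg μ m).le
      fun j hj => rowP_pOdd_zero μ hskew n j (htau n) (by omega)
  intro n m
  refine ⟨?_, ?_, ?_⟩
  · rcases le_total m n with h | h
    · exact hee n m h
    · rw [skewForm_antisymm μ hskew, hee m n h, neg_zero]
  · rcases lt_trichotomy m n with h | h | h
    · exact hoo n m h
    · subst h
      have := skewForm_antisymm μ hskew (pOdd μ m) (pOdd μ m)
      linear_combination this / 2
    · rw [skewForm_antisymm μ hskew, hoo m n h, neg_zero]
  · rcases lt_trichotomy m n with h | h | h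
    · rw [if_neg (by omega)]
      exact skewForm_zero μ _ _ (2 * m + 1) (pOdd_deg μ m).le
        fun j hj => rowP_pEven_zero μ hskew n j (by omega)
    · subst h
      rw [if_pos rfl, skewForm_rowP, pOdd_deg, Finset.sum_range_succ, pOdd_coeff,
        Finset.sum_eq_zero, rowP_pEven, rowF_top m μ hskew]
      · rw [div_eq_mul_inv]; ring
      · intro j hj
        rw [rowP_pEven_zero μ hskew m j (by have := Finset.mem_range.mp hj; omega), mul_zero]
    · rw [if_neg (by omega), skewForm_antisymm μ hskew,
        skewForm_zero μ _ _ (2 * n) (pEven_deg μ n)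
          fun j hj => rowP_pOdd_zero μ hskew m j (htau m) (by omega), neg_zero]
end
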